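/- Let I and J be ideals of R[x] with I ⊆ J and I ≠ R[x], and let (f_0, …, f_{n-1}) and (g_0, …, g_{n-1}) be canonical sequences of I and J respectively. Then J/I is a minimal ideal of R[x]/I (i.e., I ⊊ J and no ideal of R[x] lies strictly between I and J) if and only if there is exactly one index i ∈ {0, …, n-1} at which f̄_i and ḡ_i are not associates in F[x], and at this index f̄_i is an associate of γ·ḡ_i for some irreducible γ ∈ F[x]. -/

import Mathlib

open Polynomial

/-- The reduction map `R[x] → (R/πR)[x]`. -/
noncomputable def redMod {R : Type*} [CommRing R] (π : R) :
    R[X] →+* (R ⧸ Ideal.span {π})[X] :=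
  Polynomial.mapRingHom (Ideal.Quotient.mk (Ideal.span {π}))

/-- `(f 0, …, f (n-1))` is a canonical sequence of the ideal `I` of `R[x]`. -/
def IsCanonicalSequence {R : Type*} [CommRing R] (π : R) (n : ℕ)
    (I : Ideal R[X]) (f : ℕ → R[X]) : Prop :=
  ∀ i < n, (C π ^ i * f i ∈ I) ∧
    ∀ g : R[X], C π ^ i * g ∈ I →
      redMod π g = 0 ∨ (redMod π (f i) ≠ 0 ∧ (redMod π (f i)).degree ≤ (redMod π g).degree)

theorem redMod_surjective {R : Type*} [CommRing R] (π : R) :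
    Function.Surjective (redMod π) :=
  Polynomial.map_surjective _ Ideal.Quotient.mk_surjective

theorem redMod_eq_zero_iff {R : Type*} [CommRing R] (π : R) (h : R[X]) :
    redMod π h = 0 ↔ C π ∣ h := by
  rw [redMod, ← RingHom.mem_ker, Polynomial.ker_mapRingHom, Ideal.mk_ker, Ideal.map_span,
    Set.image_singleton, Ideal.mem_span_singleton]

theorem redMod_C_self {R : Type*} [CommRing R] (π : R) : redMod π (C π) = 0 :=
  (redMod_eq_zero_iff π _).2 dvd_rfl

/-- The `k`-th torsion ideal of `I`: the reductions of all `g` with `π ^ k * g ∈ I`. -/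
noncomputable def torsionIdeal {R : Type*} [CommRing R] (π : R) (k : ℕ) (I : Ideal R[X]) :
    Ideal (R ⧸ Ideal.span {π})[X] :=
  Ideal.map (redMod π) (Submodule.comap (LinearMap.mulLeft R[X] (C π ^ k)) I)

section torsionIdeal

variable {R : Type*} [CommRing R] {π : R} {k n : ℕ} {I J : Ideal R[X]}

theorem mem_torsionIdeal {p : (R ⧸ Ideal.span {π})[X]} :
    p ∈ torsionIdeal π k I ↔ ∃ g, C π ^ k * g ∈ I ∧ redMod π g = p := by
  rw [torsionIdeal, Ideal.mem_map_iff_of_surjective _ (redMod_surjective π)]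
  rfl

theorem torsionIdeal_mono (h : I ≤ J) : torsionIdeal π k I ≤ torsionIdeal π k J :=
  Ideal.map_mono (Submodule.comap_mono h)

/-- The part of `J` lying over `π ^ k` whose leading coefficients reduce into `L`. -/
noncomputable def sliceIdeal (π : R) (k : ℕ) (J : Ideal R[X])
    (L : Ideal (R ⧸ Ideal.span {π})[X]) : Ideal R[X] :=
  Submodule.map (LinearMap.mulLeft R[X] (C π ^ k)) (L.comap (redMod π)) ⊓ J

theorem mem_sliceIdeal {L : Ideal (R ⧸ Ideal.span {π})[X]} {p : R[X]} :
    p ∈ sliceIdeal π k J L ↔ (∃ g, redMod π g ∈ L ∧ C π ^ k * g = p) ∧ p ∈ J :=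
  Iff.rfl

theorem le_of_torsionIdeal_le (hnil : π ^ n = 0) (hIJ : I ≤ J)
    (h : ∀ k < n, torsionIdeal π k J ≤ torsionIdeal π k I) : J ≤ I := by
  have key : ∀ k ≤ n, ∀ g, C π ^ k * g ∈ J → C π ^ k * g ∈ I := by
    intro k hk
    induction hk using Nat.decreasingInduction with
    | self =>
      intro g _
      simp [← C_pow, hnil]
    | of_succ k hk ih =>
      intro g hg
      obtain ⟨g', hg', he⟩ := mem_torsionIdeal.1 (h k hk (mem_torsionIdeal.2 ⟨g, hg, rfl⟩))
      obtain ⟨d, hd⟩ := (redMod_eq_zero_iff π (g - g')).1 (by rw [map_sub, he, sub_self])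
      have e : C π ^ (k + 1) * d = C π ^ k * g - C π ^ k * g' := by
        rw [pow_succ, mul_assoc, ← hd, mul_sub]
      have := ih d (e ▸ J.sub_mem hg (hIJ hg'))
      rw [e] at this
      simpa using I.add_mem this hg'
  intro g hg
  simpa using key 0 n.zero_le g (by simpa using hg)

theorem eq_of_torsionIdeal_eq (hnil : π ^ n = 0) (hIJ : I ≤ J)
    (h : ∀ k < n, torsionIdeal π k I = torsionIdeal π k J) : I = J :=
  le_antisymm hIJ (le_of_torsionIdeal_le hnil hIJ fun k hk => (h k hk).ge)

theorem exists_torsionIdeal_covBy_of_covBy (hnil : π ^ n = 0) (hIJ : I ⋖ J) :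
    ∃ i < n, torsionIdeal π i I ⋖ torsionIdeal π i J ∧
      ∀ j < n, j ≠ i → torsionIdeal π j I = torsionIdeal π j J := by
  have dich : ∀ k L, sliceIdeal π k J L ≤ I ∨ I ⊔ sliceIdeal π k J L = J := by
    intro k L
    have := hIJ.eq_or_eq (c := I ⊔ sliceIdeal π k J L) le_sup_left
      (sup_le hIJ.le inf_le_right)
    rwa [sup_eq_left] at this
  have hex : ∃ k, sliceIdeal π k J ⊤ ≤ I := by
    refine ⟨n, fun p hp => ?_⟩
    obtain ⟨⟨g, -, rfl⟩, -⟩ := mem_sliceIdeal.1 hp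
    simp [← C_pow, hnil]
  obtain ⟨i, hi, hmin⟩ : ∃ i, sliceIdeal π (i + 1) J ⊤ ≤ I ∧ ¬ sliceIdeal π i J ⊤ ≤ I := by
    classical
    have h0 : Nat.find hex ≠ 0 := by
      intro h0
      refine hIJ.lt.not_ge fun p hp => ?_
      refine (Nat.find_eq_zero hex).1 h0 (mem_sliceIdeal.2 ⟨⟨p, ?_, ?_⟩, hp⟩) <;> simp
    obtain ⟨i, hi⟩ := Nat.exists_eq_succ_of_ne_zero h0
    have hspec := Nat.find_spec hex
    rw [hi] at hspec
    exact ⟨i, hspec, Nat.find_min hex (by omega)⟩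
  have hsup := (dich i ⊤).resolve_left hmin
  have hne : ∀ j < n, j ≠ i → torsionIdeal π j I = torsionIdeal π j J := by
    intro j _ hji
    refine le_antisymm (torsionIdeal_mono hIJ.le) fun p hp => ?_
    obtain ⟨g, hg, rfl⟩ := mem_torsionIdeal.1 hp
    rcases lt_or_gt_of_ne hji with hlt | hgt
    · have hg' := hg
      rw [← hsup] at hg'
      obtain ⟨a, ha, b, hb, hab⟩ := Submodule.mem_sup.1 hg'
      obtain ⟨⟨h, -, rfl⟩, -⟩ := mem_sliceIdeal.1 hb
      obtain ⟨d, rfl⟩ := Nat.exists_eq_add_of_lt hlt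
      refine mem_torsionIdeal.2 ⟨g - C π ^ (d + 1) * h, ?_, ?_⟩
      · convert ha using 1
        linear_combination -hab
      · simp [redMod_C_self]
    · obtain ⟨d, rfl⟩ := Nat.exists_eq_add_of_lt hgt
      refine mem_torsionIdeal.2 ⟨g, hi (mem_sliceIdeal.2 ⟨⟨C π ^ d * g, trivial, ?_⟩, hg⟩), rfl⟩
      ring
  have hneq : i < n ∧ torsionIdeal π i I ≠ torsionIdeal π i J := by
    by_contra hcon
    refine hIJ.ne (eq_of_torsionIdeal_eq hnil hIJ.le fun k hk => ?_)
    by_cases hki : k = i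
    · subst hki
      tauto
    · exact hne k hk hki
  refine ⟨i, hneq.1, ⟨lt_of_le_of_ne (torsionIdeal_mono hIJ.le) hneq.2, ?_⟩, hne⟩
  intro L hIL hLJ
  rcases dich i L with h | h
  · refine hIL.not_ge fun p hp => ?_
    obtain ⟨g, hg, rfl⟩ := mem_torsionIdeal.1 (hLJ.le hp)
    exact mem_torsionIdeal.2 ⟨g, h (mem_sliceIdeal.2 ⟨⟨g, hp, rfl⟩, hg⟩), rfl⟩
  · refine hLJ.not_ge fun p hp => ?_
    obtain ⟨g, hg, rfl⟩ := mem_torsionIdeal.1 hp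
    rw [← h] at hg
    obtain ⟨a, ha, b, hb, hab⟩ := Submodule.mem_sup.1 hg
    obtain ⟨⟨d, hd, rfl⟩, -⟩ := mem_sliceIdeal.1 hb
    have : redMod π (g - d) ∈ L := hIL.le (mem_torsionIdeal.2 ⟨g - d, by
      convert ha using 1
      linear_combination -hab, rfl⟩)
    simpa using L.add_mem this hd

theorem covBy_of_torsionIdeal_covBy (hnil : π ^ n = 0) (hIJ : I ≤ J) {i : ℕ}
    (hi : torsionIdeal π i I ⋖ torsionIdeal π i J)
    (hne : ∀ j < n, j ≠ i → torsionIdeal π j I = torsionIdeal π j J) : I ⋖ J := by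
  refine ⟨lt_of_le_of_ne hIJ fun h => hi.ne (by rw [h]), fun K hIK hKJ => ?_⟩
  have hIK' (j : ℕ) := torsionIdeal_mono (π := π) (k := j) hIK.le
  have hKJ' (j : ℕ) := torsionIdeal_mono (π := π) (k := j) hKJ.le
  rcases hi.eq_or_eq (hIK' i) (hKJ' i) with h | h
  · refine hIK.ne (eq_of_torsionIdeal_eq hnil hIK.le fun k hk => ?_)
    by_cases hki : k = i
    · exact hki ▸ h.symm
    · exact le_antisymm (hIK' k) ((hKJ' k).trans (hne k hk hki).ge)
  · refine hKJ.ne (eq_of_torsionIdeal_eq hnil hKJ.le fun k hk => ?_)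
    by_cases hki : k = i
    · exact hki ▸ h
    · exact le_antisymm (hKJ' k) ((hne k hk hki).ge.trans (hIK' k))

end torsionIdeal

theorem Polynomial.ideal_eq_span_of_degree_le {F : Type*} [Field F] {T : Ideal F[X]} {q : F[X]}
    (hq : q ∈ T) (h : ∀ p ∈ T, p = 0 ∨ (q ≠ 0 ∧ q.degree ≤ p.degree)) :
    T = Ideal.span {q} := by
  refine le_antisymm (fun p hp => ?_) ((Ideal.span_singleton_le_iff_mem _).2 hq)
  rw [Ideal.mem_span_singleton]
  rcases h p hp with rfl | ⟨hq0, -⟩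
  · exact dvd_zero q
  have hmod : p % q ∈ T := by
    rw [EuclideanDomain.mod_eq_sub_mul_div]
    exact T.sub_mem hp (T.mul_mem_right _ hq)
  rcases h _ hmod with h0 | ⟨-, hle⟩
  · exact EuclideanDomain.mod_eq_zero.1 h0
  · exact absurd hle (not_le.2 (degree_mod_lt p hq0))

theorem Ideal.span_singleton_covBy_iff {P : Type*} [CommRing P] [IsDomain P]
    [IsPrincipalIdealRing P] (hP : ¬ IsField P) {a b : P} :
    Ideal.span {a} ⋖ Ideal.span {b} ↔
      ¬ Associated a b ∧ ∃ γ, Irreducible γ ∧ Associated a (γ * b) := by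
  constructor
  · intro h
    refine ⟨fun hab => h.ne (Ideal.span_singleton_eq_span_singleton.2 hab), ?_⟩
    obtain ⟨γ, rfl⟩ := Ideal.span_singleton_le_span_singleton.1 h.le
    have hb : b ≠ 0 := by
      rintro rfl
      simp at h
    have factor : ∀ x y, γ = x * y → IsUnit y ∨ b * γ ∣ b * y := by
      rintro x y rfl
      rcases h.eq_or_eq (c := Ideal.span {b * y})
        (Ideal.span_singleton_le_span_singleton.2 ⟨x, by ring⟩)
        (Ideal.span_singleton_le_span_singleton.2 ⟨y, rfl⟩) with h' | h'
      · exact .inr (Ideal.span_singleton_le_span_singleton.1 h'.le)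
      · have := Ideal.span_singleton_le_span_singleton.1 h'.ge
        exact .inl (isUnit_of_dvd_one ((mul_dvd_mul_iff_left hb).1 (by simpa using this)))
    have hγ : γ ≠ 0 := by
      rintro rfl
      refine hP ⟨exists_pair_ne P, mul_comm, fun {y} hy => ?_⟩
      rcases factor 0 y (zero_mul y).symm with hu | hd
      · exact hu.exists_right_inv
      · simp [hb, hy] at hd
    refine ⟨γ, ⟨fun hu => h.ne ?_, fun x y hxy => ?_⟩, by rw [mul_comm]⟩
    · exact Ideal.span_singleton_mul_right_unit hu b
    · rcases factor x y hxy with hu | hd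
      · exact .inr hu
      · rw [mul_dvd_mul_iff_left hb, hxy] at hd
        have hy : y ≠ 0 := right_ne_zero_of_mul (hxy ▸ hγ)
        exact .inl (isUnit_of_dvd_one ((mul_dvd_mul_iff_right hy).1 (by simpa using hd)))
  · rintro ⟨hab, γ, hγ, h⟩
    have hb : b ≠ 0 := by
      rintro rfl
      exact hab (by simpa using h)
    rw [Ideal.span_singleton_eq_span_singleton.2 h]
    refine ⟨lt_of_le_of_ne (Ideal.span_singleton_le_span_singleton.2 (dvd_mul_left b γ))
      fun he => hab (h.trans (Ideal.span_singleton_eq_span_singleton.1 he)), fun L h1 h2 => ?_⟩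
    obtain ⟨l, rfl⟩ := (IsPrincipalIdealRing.principal L).principal
    rw [← Ideal.span] at h1 h2
    obtain ⟨c, rfl⟩ := Ideal.span_singleton_le_span_singleton.1 h2.le
    obtain ⟨d, hd⟩ := Ideal.span_singleton_le_span_singleton.1 h1.le
    have hcd : γ = c * d := mul_left_cancel₀ hb (by linear_combination hd)
    rcases hγ.isUnit_or_isUnit hcd with hu | hu
    · exact h2.ne (Ideal.span_singleton_mul_right_unit hu b)
    · refine h1.ne ?_
      rw [hd, Ideal.span_singleton_mul_right_unit hu]

theorem IsCanonicalSequence.torsionIdeal_eq {R : Type*} [CommRing R] {π : R} {n : ℕ}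
    {I : Ideal R[X]} {f : ℕ → R[X]} (hπ : (Ideal.span {π}).IsMaximal)
    (hf : IsCanonicalSequence π n I f) {i : ℕ} (hi : i < n) :
    torsionIdeal π i I = Ideal.span {redMod π (f i)} := by
  let := Ideal.Quotient.field (Ideal.span {π})
  refine Polynomial.ideal_eq_span_of_degree_le (mem_torsionIdeal.2 ⟨_, (hf i hi).1, rfl⟩) ?_
  intro p hp
  obtain ⟨g, hg, rfl⟩ := mem_torsionIdeal.1 hp
  exact (hf i hi).2 g hg

/-- Proposition 4.3: `J/I` is a minimal ideal of `R[x]/I` iff the invariant sequence of `J`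
is obtained from that of `I` by dividing exactly one entry by an irreducible polynomial. -/
theorem minimal_quotient_iff_boxprec {R : Type*} [CommRing R] [IsLocalRing R]
    (π : R) (n : ℕ) (hn : 1 ≤ n)
    (hmax : IsLocalRing.maximalIdeal R = Ideal.span {π})
    (hnil : π ^ n = 0) (hne : π ^ (n - 1) ≠ 0)
    (I J : Ideal R[X]) (hIJ : I ≤ J) (hI : I ≠ ⊤)
    (f g : ℕ → R[X])
    (hf : IsCanonicalSequence π n I f) (hg : IsCanonicalSequence π n J g) :
    (I < J ∧ ∀ K : Ideal R[X], I ≤ K → K ≤ J → K = I ∨ K = J) ↔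
      (∃ i < n, ¬ Associated (redMod π (f i)) (redMod π (g i)) ∧
        (∀ j < n, j ≠ i → Associated (redMod π (f j)) (redMod π (g j))) ∧
        ∃ γ : (R ⧸ Ideal.span {π})[X], Irreducible γ ∧
          Associated (redMod π (f i)) (γ * redMod π (g i))) := by
  have hπ : (Ideal.span {π}).IsMaximal := hmax ▸ inferInstance
  let := Ideal.Quotient.field (Ideal.span {π})
  have hassoc : ∀ j < n, torsionIdeal π j I = torsionIdeal π j J ↔
      Associated (redMod π (f j)) (redMod π (g j)) := by
    intro j hj
    rw [hf.torsionIdeal_eq hπ hj, hg.torsionIdeal_eq hπ hj,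
      Ideal.span_singleton_eq_span_singleton]
  have hcov : ∀ j < n, torsionIdeal π j I ⋖ torsionIdeal π j J ↔
      ¬ Associated (redMod π (f j)) (redMod π (g j)) ∧
        ∃ γ : (R ⧸ Ideal.span {π})[X], Irreducible γ ∧
          Associated (redMod π (f j)) (γ * redMod π (g j)) := by
    intro j hj
    rw [hf.torsionIdeal_eq hπ hj, hg.torsionIdeal_eq hπ hj]
    exact Ideal.span_singleton_covBy_iff (Polynomial.not_isField _)
  rw [← covBy_iff_lt_and_eq_or_eq]
  constructor
  · intro h
    obtain ⟨i, hi, hc, hne⟩ := exists_torsionIdeal_covBy_of_covBy hnil h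
    obtain ⟨h1, h2⟩ := (hcov i hi).1 hc
    exact ⟨i, hi, h1, fun j hj hji => (hassoc j hj).1 (hne j hj hji), h2⟩
  · rintro ⟨i, hi, h1, hne, h2⟩
    exact covBy_of_torsionIdeal_covBy hnil hIJ ((hcov i hi).2 ⟨h1, h2⟩)
      fun j hj hji => (hassoc j hj).2 (hne j hj hji)
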